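/- Let α > 0 be such that the root-structure assumption holds at level α, set S = m+n+2 and (ρ_1, …, ρ_S) = (β_{1,α}, …, β_{m+1,α}, γ_{1,α}, …, γ_{n+1,α}), and let h < H be reals. Then the S×S real matrix A^{h,H,α} whose rows are, in order: (e^{ρ_1 h}, …, e^{ρ_S h}); (e^{ρ_1 H}, …, e^{ρ_S H}); the n rows (e^{ρ_1 h}/(θ_l + ρ_1), …, e^{ρ_S h}/(θ_l + ρ_S)) for l = 1, …, n; and the m rows (e^{ρ_1 H}/(η_k − ρ_1), …, e^{ρ_S H}/(η_k − ρ_S)) for k = 1, …, m, is nonsingular. -/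

import Mathlib

open Real

/-- The root-structure assumption at level `a` (copied from the paper's
Assumption 2.2): `G(ζ) = a` has exactly `m+n+2` distinct real solutions,
namely `m+1` positive roots `β` interlacing with the `η`'s and `n+1` negative
roots `γ` interlacing with the `−θ`'s. -/
def RootStructure (m n : ℕ) (η : Fin m → ℝ) (θ : Fin n → ℝ) (G : ℝ → ℝ) (a : ℝ)
    (β : Fin (m + 1) → ℝ) (γ : Fin (n + 1) → ℝ) : Prop :=
  (∀ i, G (β i) = a) ∧ (∀ j, G (γ j) = a) ∧
  0 < β 0 ∧ (∀ k : Fin m, β k.castSucc < η k ∧ η k < β k.succ) ∧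
  γ 0 < 0 ∧ (∀ k : Fin n, -θ k < γ k.castSucc ∧ γ k.succ < -θ k) ∧
  (∀ ζ : ℝ, (∀ i, ζ ≠ η i) → (∀ j, ζ ≠ -θ j) → G ζ = a →
    (∃ i, ζ = β i) ∨ (∃ j, ζ = γ j))

/-- The vector `(ρ_1, …, ρ_S) = (β_1, …, β_{m+1}, γ_1, …, γ_{n+1})`,
`S = m+n+2`. -/
noncomputable def rootVec (m n : ℕ) (β : Fin (m + 1) → ℝ) (γ : Fin (n + 1) → ℝ) :
    Fin (m + n + 2) → ℝ := fun j =>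
  if hj : (j : ℕ) < m + 1 then β ⟨j, hj⟩
  else γ ⟨(j : ℕ) - (m + 1), by have := j.isLt; omega⟩

/-- The `S×S` matrix `A^{h,H,α}` of the two-sided exit problem: rows are
`(e^{ρ_j h})_j`, `(e^{ρ_j H})_j`, the `n` rows `(e^{ρ_j h}/(θ_l + ρ_j))_j`
and, finally, the `m` rows `(e^{ρ_j H}/(η_k − ρ_j))_j`. -/
noncomputable def twoSidedMatrix (m n : ℕ) (η : Fin m → ℝ) (θ : Fin n → ℝ) (h H : ℝ)
    (ρ : Fin (m + n + 2) → ℝ) : Matrix (Fin (m + n + 2)) (Fin (m + n + 2)) ℝ :=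
  Matrix.of fun i j =>
    if h0 : (i : ℕ) = 0 then Real.exp (ρ j * h)
    else if h1 : (i : ℕ) = 1 then Real.exp (ρ j * H)
    else if hi : (i : ℕ) < n + 2 then
      Real.exp (ρ j * h) / (θ ⟨(i : ℕ) - 2, by omega⟩ + ρ j)
    else
      Real.exp (ρ j * H) / (η ⟨(i : ℕ) - 2 - n, by have := i.isLt; omega⟩ - ρ j)

/-- The numerator of a rational function with a quadratic polynomial part `d + μ ζ + c ζ²` and
simple poles `z k` factors over its roots; evaluating it at a pole expresses the residue. -/
theorem residue_mul_prod_eq {ι J : Type*} [Fintype ι] [DecidableEq ι] [Fintype J]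
    (z r : ι → ℝ) (ρ : J → ℝ) (d μ c : ℝ) (hc : c ≠ 0)
    (hcard : Fintype.card J = Fintype.card ι + 2) (hρ : Function.Injective ρ)
    (hne : ∀ i j, z i ≠ ρ j)
    (hroot : ∀ j, d + μ * ρ j + c * ρ j ^ 2 + ∑ i, r i / (z i - ρ j) = 0) (i : ι) :
    r i * ∏ k, (if k = i then 1 else z i - z k) = -c * ∏ j, (z i - ρ j) := by
  classical
  set Q : Polynomial ℝ := Polynomial.X ^ 2 +
    (Polynomial.C (μ / c) * Polynomial.X + Polynomial.C (d / c)) with hQ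
  set T : Polynomial ℝ := ∏ k, (Polynomial.X - Polynomial.C (z k)) with hT
  set R : Polynomial ℝ := ∑ i, Polynomial.C (-(r i / c)) *
    ∏ k ∈ Finset.univ.erase i, (Polynomial.X - Polynomial.C (z k)) with hR
  set P : Polynomial ℝ := ∏ j, (Polynomial.X - Polynomial.C (ρ j)) with hP
  have hlin : (Polynomial.C (μ / c) * Polynomial.X + Polynomial.C (d / c)).degree
      < ((Polynomial.X : Polynomial ℝ) ^ 2).degree := by
    rw [Polynomial.degree_X_pow]
    exact lt_of_le_of_lt Polynomial.degree_linear_le (by norm_num)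
  have hQm : Q.Monic := (Polynomial.monic_X_pow 2).add_of_left hlin
  have hQd : Q.degree = 2 := by
    rw [hQ, Polynomial.degree_add_eq_left_of_degree_lt hlin, Polynomial.degree_X_pow]; rfl
  have hTm : T.Monic := Polynomial.monic_prod_of_monic _ _ fun k _ => Polynomial.monic_X_sub_C _
  have hTd : T.degree = (Fintype.card ι : ℕ) := by
    rw [hT, Polynomial.degree_prod]; simp
  have hPm : P.Monic := Polynomial.monic_prod_of_monic _ _ fun k _ => Polynomial.monic_X_sub_C _
  have hPd : P.degree = (Fintype.card J : ℕ) := by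
    rw [hP, Polynomial.degree_prod]; simp
  have hQTd : (Q * T).degree = (Fintype.card J : ℕ) := by
    rw [Polynomial.degree_mul, hQd, hTd, hcard]; push_cast; ring
  have hRd : R.degree < (Q * T).degree := by
    rw [hQTd]
    refine lt_of_le_of_lt (Polynomial.degree_sum_le _ _) ?_
    rw [Finset.sup_lt_iff (WithBot.bot_lt_coe _)]
    intro i _
    rw [← Polynomial.smul_eq_C_mul]
    refine lt_of_le_of_lt (Polynomial.degree_smul_le _ _) ?_
    rw [Polynomial.degree_prod]
    simp only [Polynomial.degree_X_sub_C, Finset.sum_const, Finset.card_erase_of_mem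
      (Finset.mem_univ i), Finset.card_univ, hcard, nsmul_eq_mul, mul_one]
    exact_mod_cast (by omega : Fintype.card ι - 1 < Fintype.card ι + 2)
  have hNm : (Q * T + R).Monic := (hQm.mul hTm).add_of_left hRd
  have hNd : (Q * T + R).degree = (Fintype.card J : ℕ) := by
    rw [Polynomial.degree_add_eq_left_of_degree_lt hRd, hQTd]
  have heq : Q * T + R = P := by
    refine Polynomial.eq_of_degree_sub_lt_of_eval_index_eq (s := Finset.univ) (v := ρ)
      hρ.injOn ?_ ?_
    · rw [Finset.card_univ, ← hNd]
      refine Polynomial.degree_sub_lt_left (by rw [hNd, hPd]) hNm.ne_zero ?_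
      rw [hNm.leadingCoeff, hPm.leadingCoeff]
    · intro j _
      have hPj : P.eval (ρ j) = 0 := by
        rw [hP, Polynomial.eval_prod]
        exact Finset.prod_eq_zero (Finset.mem_univ j) (by simp)
      have hTi : ∀ i, ∏ k ∈ Finset.univ.erase i, (ρ j - z k) =
          -(∏ k, (ρ j - z k)) / (z i - ρ j) := by
        intro i
        have h1 : z i - ρ j ≠ 0 := sub_ne_zero.2 (hne i j)
        rw [← Finset.mul_prod_erase Finset.univ _ (Finset.mem_univ i)]
        field_simp
        ring
      rw [hPj]
      simp only [hQ, hT, hR, Polynomial.eval_add, Polynomial.eval_mul, Polynomial.eval_pow,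
        Polynomial.eval_X, Polynomial.eval_C, Polynomial.eval_prod, Polynomial.eval_finsetSum,
        Polynomial.eval_sub, hTi]
      have h2 : ∑ i, -(r i / c) * (-(∏ k, (ρ j - z k)) / (z i - ρ j)) =
          (∏ k, (ρ j - z k)) / c * ∑ i, r i / (z i - ρ j) := by
        rw [Finset.mul_sum]
        refine Finset.sum_congr rfl fun i _ => ?_
        ring
      have h3 : ∑ i, r i / (z i - ρ j) = -(d + μ * ρ j + c * ρ j ^ 2) := by
        linarith [hroot j]
      rw [h2, h3]
      field_simp
      ring
  have hev := congrArg (Polynomial.eval (z i)) heq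
  have hT0 : T.eval (z i) = 0 := by
    rw [hT, Polynomial.eval_prod]
    exact Finset.prod_eq_zero (Finset.mem_univ i) (by simp)
  have hR0 : R.eval (z i) = -(r i / c) * ∏ k, (if k = i then 1 else z i - z k) := by
    rw [hR, Polynomial.eval_finsetSum, Finset.sum_eq_single i]
    · rw [← Finset.mul_prod_erase Finset.univ (fun k => if k = i then 1 else z i - z k)
        (Finset.mem_univ i)]
      simp only [Polynomial.eval_mul, Polynomial.eval_C, Polynomial.eval_prod,
        Polynomial.eval_sub, Polynomial.eval_X, if_true, one_mul]
      congr 1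
      refine Finset.prod_congr rfl fun k hk => ?_
      rw [if_neg (Finset.ne_of_mem_erase hk)]
    · intro k _ hk
      rw [Polynomial.eval_mul, Polynomial.eval_prod,
        Finset.prod_eq_zero (Finset.mem_erase.2 ⟨hk.symm, Finset.mem_univ i⟩) (by simp), mul_zero]
    · intro h; exact absurd (Finset.mem_univ i) h
  rw [Polynomial.eval_add, Polynomial.eval_mul, hT0, mul_zero, zero_add, hR0, hP,
    Polynomial.eval_prod] at hev
  simp only [Polynomial.eval_sub, Polynomial.eval_X, Polynomial.eval_C] at hev
  rw [← hev]
  field_simp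

theorem strictMono_of_interlacing {m : ℕ} {η : Fin m → ℝ} {β : Fin (m + 1) → ℝ}
    (hβ : ∀ k : Fin m, β k.castSucc < η k ∧ η k < β k.succ) : StrictMono β :=
  Fin.strictMono_iff_lt_succ.2 fun k => (hβ k).1.trans (hβ k).2

theorem interlacing_lt {m : ℕ} {η : Fin m → ℝ} {β : Fin (m + 1) → ℝ}
    (hβ : ∀ k : Fin m, β k.castSucc < η k ∧ η k < β k.succ) {i : Fin m} {j : Fin (m + 1)}
    (hij : j ≤ i.castSucc) : β j < η i :=
  ((strictMono_of_interlacing hβ).monotone hij).trans_lt (hβ i).1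

theorem lt_interlacing {m : ℕ} {η : Fin m → ℝ} {β : Fin (m + 1) → ℝ}
    (hβ : ∀ k : Fin m, β k.castSucc < η k ∧ η k < β k.succ) {i : Fin m} {j : Fin (m + 1)}
    (hij : i.castSucc < j) : η i < β j :=
  (hβ i).2.trans_le ((strictMono_of_interlacing hβ).monotone
    (Fin.castSucc_lt_iff_succ_le.1 hij))

theorem interlacing_ne {m : ℕ} {η : Fin m → ℝ} {β : Fin (m + 1) → ℝ}
    (hβ : ∀ k : Fin m, β k.castSucc < η k ∧ η k < β k.succ) (i : Fin m) (j : Fin (m + 1)) :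
    η i ≠ β j := by
  rcases le_or_gt j i.castSucc with hij | hij
  · exact (interlacing_lt hβ hij).ne'
  · exact (lt_interlacing hβ hij).ne

theorem prod_mul_prod_neg_of_interlacing {m : ℕ} {η : Fin m → ℝ} {β : Fin (m + 1) → ℝ}
    (hη : StrictMono η) (hβ : ∀ k : Fin m, β k.castSucc < η k ∧ η k < β k.succ) (i : Fin m) :
    (∏ k, (if k = i then 1 else η i - η k)) * ∏ j, (η i - β j) < 0 := by
  rw [Fin.prod_univ_succAbove _ i.castSucc, mul_left_comm, ← Finset.prod_mul_distrib,
    ← Finset.mul_prod_erase Finset.univ _ (Finset.mem_univ i)]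
  refine mul_neg_of_pos_of_neg (sub_pos.2 (hβ i).1) (mul_neg_of_neg_of_pos ?_ ?_)
  · rw [if_pos rfl, Fin.succAbove_castSucc_self, one_mul]
    exact sub_neg.2 (hβ i).2
  · refine Finset.prod_pos fun k hk => ?_
    have hki := Finset.ne_of_mem_erase hk
    rw [if_neg hki]
    rcases lt_or_gt_of_ne hki with h | h
    · rw [Fin.succAbove_of_castSucc_lt _ _ (by simpa using h)]
      exact mul_pos (sub_pos.2 (hη h)) (sub_pos.2 (interlacing_lt hβ (by simpa using h.le)))
    · rw [Fin.succAbove_of_le_castSucc _ _ (by simpa using h.le)]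
      refine mul_pos_of_neg_of_neg (sub_neg.2 (hη h)) (sub_neg.2 (lt_interlacing hβ ?_))
      exact Fin.castSucc_lt_succ_iff.2 h.le

/-- Interlacing of the roots with the poles forces the residues to be positive. -/
theorem residue_pos_of_interlacing {m n : ℕ} {η a : Fin m → ℝ} {θ b : Fin n → ℝ}
    {β : Fin (m + 1) → ℝ} {γ : Fin (n + 1) → ℝ} {d μ c : ℝ} (hc : 0 < c)
    (hη0 : ∀ i, 0 < η i) (hθ0 : ∀ j, 0 < θ j) (hη : StrictMono η)
    (hβ0 : ∀ i, 0 < β i) (hγ0 : ∀ j, γ j < 0)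
    (hβ : ∀ k : Fin m, β k.castSucc < η k ∧ η k < β k.succ)
    (hγ : ∀ k : Fin n, -γ k.castSucc < θ k ∧ θ k < -γ k.succ)
    (hFβ : ∀ j, d + μ * β j + c * β j ^ 2 +
      (∑ i, a i / (η i - β j) + ∑ l, b l / (θ l + β j)) = 0)
    (hFγ : ∀ j, d + μ * γ j + c * γ j ^ 2 +
      (∑ i, a i / (η i - γ j) + ∑ l, b l / (θ l + γ j)) = 0) (i : Fin m) :
    0 < a i := by
  have hneg : ∀ l x, -b l / (-θ l - x) = b l / (θ l + x) := fun l x => by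
    rw [← neg_div_neg_eq]; congr 1 <;> ring
  have hγm := strictMono_of_interlacing (β := fun j => -γ j) hγ
  have key := residue_mul_prod_eq (Sum.elim η fun l => -θ l) (Sum.elim a fun l => -b l)
    (Sum.elim β γ) d μ c hc.ne' (by simp; ring)
    (by
      refine Function.Injective.sumElim (strictMono_of_interlacing hβ).injective ?_ ?_
      · exact fun x y hxy => hγm.injective (neg_inj.2 hxy)
      · exact fun x y => ((hγ0 y).trans (hβ0 x)).ne')
    (by
      rintro (i | l) (j | j)
      · exact interlacing_ne hβ i j
      · exact ((hγ0 j).trans (hη0 i)).ne'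
      · exact ((neg_neg_of_pos (hθ0 l)).trans (hβ0 j)).ne
      · exact fun h => interlacing_ne (β := fun j => -γ j) hγ l j (by
          simp only [Sum.elim_inr] at h; linarith))
    (by
      rintro (j | j)
      · simpa [Fintype.sum_sum_type, hneg] using hFβ j
      · simpa [Fintype.sum_sum_type, hneg] using hFγ j)
    (Sum.inl i)
  simp only [Fintype.prod_sum_type, Sum.elim_inl, Sum.elim_inr, Sum.inl.injEq, reduceCtorEq,
    if_false] at key
  have hAP := prod_mul_prod_neg_of_interlacing hη hβ i
  have hB : 0 < ∏ l, (η i - -θ l) :=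
    Finset.prod_pos fun l _ => by linarith [hη0 i, hθ0 l]
  have hC : 0 < ∏ j, (η i - γ j) :=
    Finset.prod_pos fun j _ => by linarith [hη0 i, hγ0 j]
  set A := ∏ k, (if k = i then 1 else η i - η k)
  set P := ∏ j, (η i - β j)
  set B := ∏ l, (η i - -θ l)
  set C := ∏ j, (η i - γ j)
  have hpos : 0 < a i * (A ^ 2 * B) := by
    have : a i * (A ^ 2 * B) = c * C * -(A * P) := by linear_combination A * key
    rw [this]
    exact mul_pos (mul_pos hc hC) (neg_pos.2 hAP)
  exact pos_of_mul_pos_left hpos (by positivity)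

/-- A finite linear combination of exponentials. -/
noncomputable def expSum {J : Type*} [Fintype J] (w ρ : J → ℝ) (x : ℝ) : ℝ :=
  ∑ j, w j * Real.exp (ρ j * x)

theorem hasDerivAt_expSum {J : Type*} [Fintype J] (w ρ : J → ℝ) (x : ℝ) :
    HasDerivAt (expSum w ρ) (expSum (fun j => w j * ρ j) ρ x) x := by
  unfold expSum
  refine HasDerivAt.fun_sum fun j _ => ?_
  have h1 := (((hasDerivAt_id x).const_mul (ρ j)).exp).const_mul (w j)
  refine h1.congr_deriv ?_
  simp only [id]
  ring

theorem deriv_expSum {J : Type*} [Fintype J] (w ρ : J → ℝ) :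
    deriv (expSum w ρ) = expSum (fun j => w j * ρ j) ρ :=
  funext fun x => (hasDerivAt_expSum w ρ x).deriv

theorem continuous_expSum {J : Type*} [Fintype J] (w ρ : J → ℝ) : Continuous (expSum w ρ) :=
  continuous_iff_continuousAt.2 fun x => (hasDerivAt_expSum w ρ x).continuousAt

theorem eq_zero_of_expSum_eq_zero_on_Ioo {S : ℕ} {w ρ : Fin S → ℝ}
    (hρ : Function.Injective ρ) {h H : ℝ} (hhH : h < H)
    (hzero : ∀ x ∈ Set.Ioo h H, expSum w ρ x = 0) : w = 0 := by
  have hall : ∀ k : ℕ, ∀ x ∈ Set.Ioo h H, expSum (fun j => w j * ρ j ^ k) ρ x = 0 := by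
    intro k
    induction k with
    | zero => simpa using hzero
    | succ k ih =>
      intro x hx
      have h1 := hasDerivAt_expSum (fun j => w j * ρ j ^ k) ρ x
      have h2 : expSum (fun j => w j * ρ j ^ k) ρ =ᶠ[nhds x] fun _ => 0 :=
        Filter.eventually_of_mem (Ioo_mem_nhds hx.1 hx.2) ih
      have h3 := h1.unique ((hasDerivAt_const x (0 : ℝ)).congr_of_eventuallyEq h2)
      simpa only [pow_succ, mul_assoc] using h3
  obtain ⟨x, hx⟩ := Set.nonempty_Ioo.2 hhH
  have hv := Matrix.eq_zero_of_forall_pow_sum_mul_pow_eq_zero (f := ρ)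
    (v := fun j => w j * Real.exp (ρ j * x)) hρ (fun k => by
      rw [← hall k x hx]
      exact Finset.sum_congr rfl fun j _ => by ring)
  funext j
  have hj := congrFun hv j
  simpa using hj

theorem deriv_deriv_nonpos_of_isLocalMax {f : ℝ → ℝ} {x : ℝ} (hf : ContinuousAt f x)
    (hmax : IsLocalMax f x) : deriv (deriv f) x ≤ 0 := by
  by_contra! hpos
  have hmin := isLocalMin_of_deriv_deriv_pos hpos hmax.deriv_eq_zero hf
  have hconst : f =ᶠ[nhds x] fun _ => f x := by
    filter_upwards [hmax, hmin] with y h1 h2 using le_antisymm h1 h2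
  have h2 := hconst.deriv.deriv_eq
  simp at h2
  exact hpos.ne' h2

theorem expSum_div_sub_le {J : Type*} [Fintype J] {w ρ : J → ℝ} {η h H M : ℝ} (hη : 0 < η)
    (hne : ∀ j, η ≠ ρ j) (hM : 0 ≤ M) (hle : ∀ x ∈ Set.Icc h H, expSum w ρ x ≤ M)
    (hH : expSum (fun j => w j / (η - ρ j)) ρ H = 0) {x : ℝ} (hx : x ∈ Set.Icc h H) :
    expSum (fun j => w j / (η - ρ j)) ρ x ≤ M / η := by
  set K := expSum (fun j => w j / (η - ρ j)) ρ with hK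
  have hKd : ∀ y, HasDerivAt K (η * K y - expSum w ρ y) y := fun y => by
    refine (hasDerivAt_expSum _ ρ y).congr_deriv ?_
    simp only [hK, expSum, Finset.mul_sum, ← Finset.sum_sub_distrib]
    refine Finset.sum_congr rfl fun j _ => ?_
    have := sub_ne_zero.2 (hne j)
    field_simp
    ring
  have hgd : ∀ y, HasDerivAt (fun y => (K y - M / η) * Real.exp (-η * y))
      ((M - expSum w ρ y) * Real.exp (-η * y)) y := fun y => by
    refine (((hKd y).sub_const (M / η)).mul
      (((hasDerivAt_id y).const_mul (-η)).exp)).congr_deriv ?_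
    simp only [id]
    field_simp
    ring
  have hmono : MonotoneOn (fun y => (K y - M / η) * Real.exp (-η * y)) (Set.Icc h H) := by
    refine monotoneOn_of_deriv_nonneg (convex_Icc h H)
      (fun y _ => (hgd y).continuousAt.continuousWithinAt)
      (fun y _ => (hgd y).differentiableAt.differentiableWithinAt) fun y hy => ?_
    rw [(hgd y).deriv]
    exact mul_nonneg (sub_nonneg.2 (hle y (interior_subset hy))) (Real.exp_pos _).le
  have h1 := hmono hx (Set.right_mem_Icc.2 (hx.1.trans hx.2)) hx.2
  simp only [hH, zero_sub] at h1
  have h2 : (K x - M / η) * Real.exp (-η * x) ≤ 0 :=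
    h1.trans (mul_nonpos_of_nonpos_of_nonneg (neg_nonpos.2 (by positivity)) (Real.exp_pos _).le)
  linarith [nonpos_of_mul_nonpos_left h2 (Real.exp_pos _)]

theorem expSum_div_add_le {J : Type*} [Fintype J] {w ρ : J → ℝ} {θ h H M : ℝ} (hθ : 0 < θ)
    (hne : ∀ j, θ + ρ j ≠ 0) (hM : 0 ≤ M) (hle : ∀ x ∈ Set.Icc h H, expSum w ρ x ≤ M)
    (hh : expSum (fun j => w j / (θ + ρ j)) ρ h = 0) {x : ℝ} (hx : x ∈ Set.Icc h H) :
    expSum (fun j => w j / (θ + ρ j)) ρ x ≤ M / θ := by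
  have hrefl : ∀ (v : J → ℝ) (y : ℝ), expSum v (fun j => -ρ j) y = expSum v ρ (-y) :=
    fun v y => by simp [expSum]
  have key := expSum_div_sub_le (w := w) (ρ := fun j => -ρ j) (h := -H) (H := -h) (x := -x) hθ
    (fun j hj => hne j (by rw [hj]; ring)) hM
    (fun y hy => by
      rw [hrefl]
      exact hle _ ⟨by linarith [hy.2], by linarith [hy.1]⟩)
    (by simpa [hrefl] using hh) ⟨by linarith [hx.2], by linarith [hx.1]⟩
  simpa [hrefl] using key

/-- Maximum principle for an integro-differential operator with exponential kernels: `hroot` says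
that its symbol vanishes at the exponents, and the last four hypotheses are the exit conditions at
`h` and `H`. -/
theorem expSum_nonpos_of_exit_conditions {ι κ J : Type*} [Fintype ι] [Fintype κ] [Fintype J]
    {η a : ι → ℝ} {θ b : κ → ℝ} {ρ w : J → ℝ} {d μ c h H : ℝ} (hc : 0 ≤ c)
    (hη : ∀ i, 0 < η i) (hθ : ∀ l, 0 < θ l) (ha : ∀ i, 0 ≤ a i) (hb : ∀ l, 0 ≤ b l)
    (hηρ : ∀ i j, η i ≠ ρ j) (hθρ : ∀ l j, θ l + ρ j ≠ 0)
    (hroot : ∀ j, d + μ * ρ j + c * ρ j ^ 2 +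
      (∑ i, a i / (η i - ρ j) + ∑ l, b l / (θ l + ρ j)) = 0)
    (hkill : d + (∑ i, a i / η i + ∑ l, b l / θ l) < 0)
    (hwh : expSum w ρ h = 0) (hwH : expSum w ρ H = 0)
    (hwθ : ∀ l, expSum (fun j => w j / (θ l + ρ j)) ρ h = 0)
    (hwη : ∀ i, expSum (fun j => w j / (η i - ρ j)) ρ H = 0) :
    ∀ x ∈ Set.Icc h H, expSum w ρ x ≤ 0 := by
  intro x hx
  by_contra! hpos
  obtain ⟨x₀, hx₀, hmax⟩ := isCompact_Icc.exists_isMaxOn ⟨x, hx⟩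
    (continuous_expSum w ρ).continuousOn
  have hM : 0 < expSum w ρ x₀ := hpos.trans_le (hmax hx)
  have hx₀h : h ≠ x₀ := fun e => by rw [← e, hwh] at hM; exact hM.false
  have hx₀H : x₀ ≠ H := fun e => by rw [e, hwH] at hM; exact hM.false
  have hloc : IsLocalMax (expSum w ρ) x₀ :=
    hmax.isLocalMax (Icc_mem_nhds (lt_of_le_of_ne hx₀.1 hx₀h) (lt_of_le_of_ne hx₀.2 hx₀H))
  have hd1 := hloc.deriv_eq_zero
  have hd2 := deriv_deriv_nonpos_of_isLocalMax (continuous_expSum w ρ).continuousAt hloc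
  simp only [deriv_expSum] at hd1 hd2
  have hsumη : ∑ i, a i * expSum (fun j => w j / (η i - ρ j)) ρ x₀ ≤
      expSum w ρ x₀ * ∑ i, a i / η i := by
    rw [Finset.mul_sum]
    refine Finset.sum_le_sum fun i _ => ?_
    refine (mul_le_mul_of_nonneg_left
      (expSum_div_sub_le (hη i) (hηρ i) hM.le (fun y hy => hmax hy) (hwη i) hx₀)
      (ha i)).trans_eq ?_
    ring
  have hsumθ : ∑ l, b l * expSum (fun j => w j / (θ l + ρ j)) ρ x₀ ≤
      expSum w ρ x₀ * ∑ l, b l / θ l := by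
    rw [Finset.mul_sum]
    refine Finset.sum_le_sum fun l _ => ?_
    refine (mul_le_mul_of_nonneg_left
      (expSum_div_add_le (hθ l) (hθρ l) hM.le (fun y hy => hmax hy) (hwθ l) hx₀)
      (hb l)).trans_eq ?_
    ring
  have heq : d * expSum w ρ x₀ + μ * expSum (fun j => w j * ρ j) ρ x₀ +
      c * expSum (fun j => w j * ρ j * ρ j) ρ x₀ +
      (∑ i, a i * expSum (fun j => w j / (η i - ρ j)) ρ x₀ +
       ∑ l, b l * expSum (fun j => w j / (θ l + ρ j)) ρ x₀) = 0 := by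
    simp only [expSum, Finset.mul_sum]
    rw [Finset.sum_comm (s := (Finset.univ : Finset ι)),
      Finset.sum_comm (s := (Finset.univ : Finset κ))]
    simp only [← Finset.sum_add_distrib]
    refine Finset.sum_eq_zero fun j _ => ?_
    have h1 : ∑ i, a i * (w j / (η i - ρ j) * Real.exp (ρ j * x₀)) =
        w j * Real.exp (ρ j * x₀) * ∑ i, a i / (η i - ρ j) := by
      rw [Finset.mul_sum]; exact Finset.sum_congr rfl fun i _ => by ring
    have h2 : ∑ l, b l * (w j / (θ l + ρ j) * Real.exp (ρ j * x₀)) =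
        w j * Real.exp (ρ j * x₀) * ∑ l, b l / (θ l + ρ j) := by
      rw [Finset.mul_sum]; exact Finset.sum_congr rfl fun l _ => by ring
    rw [h1, h2]
    linear_combination w j * Real.exp (ρ j * x₀) * hroot j
  have hcd : c * expSum (fun j => w j * ρ j * ρ j) ρ x₀ ≤ 0 :=
    mul_nonpos_of_nonneg_of_nonpos hc hd2
  have hk := mul_neg_of_pos_of_neg hM hkill
  rw [hd1] at heq
  linarith

/-- Under the root-structure assumption at level `α > 0`, for any
barriers `h < H` the matrix `A^{h,H,α}` is nonsingular. -/
theorem two_sided_exit_matrix_nonsingular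
    (m n : ℕ) (hm : 0 < m) (hn : 0 < n)
    (μ σ lam p_u q_d : ℝ)
    (hσ : 0 < σ) (hlam : 0 < lam)
    (hpu : 0 ≤ p_u) (hqd : 0 ≤ q_d) (hpq : p_u + q_d = 1)
    (p : Fin m → ℝ) (q : Fin n → ℝ)
    (hp : ∑ i, p i = 1) (hq : ∑ j, q j = 1)
    (η : Fin m → ℝ) (θ : Fin n → ℝ)
    (hη0 : 0 < η ⟨0, hm⟩) (hθ0 : 0 < θ ⟨0, hn⟩)
    (hηmono : StrictMono η) (hθmono : StrictMono θ)
    (G : ℝ → ℝ)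
    (hG : ∀ ζ : ℝ, (∀ i, ζ ≠ η i) → (∀ j, ζ ≠ -θ j) →
      G ζ = μ * ζ + σ ^ 2 / 2 * ζ ^ 2 +
        lam * (p_u * ∑ i, p i * η i / (η i - ζ) +
               q_d * ∑ j, q j * θ j / (θ j + ζ) - 1))
    (α : ℝ) (hα : 0 < α)
    (β : Fin (m + 1) → ℝ) (γ : Fin (n + 1) → ℝ)
    (hroots : RootStructure m n η θ G α β γ)
    (h H : ℝ) (hhH : h < H) :
    (twoSidedMatrix m n η θ h H (rootVec m n β γ)).det ≠ 0 := by
  obtain ⟨hGβ, hGγ, hβ00, hβ, hγ00, hγ, -⟩ := hroots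
  have hη : ∀ i, 0 < η i := fun i => hη0.trans_le (hηmono.monotone (Nat.zero_le _))
  have hθ : ∀ l, 0 < θ l := fun l => hθ0.trans_le (hθmono.monotone (Nat.zero_le _))
  have hγ' : ∀ k : Fin n, -γ k.castSucc < θ k ∧ θ k < -γ k.succ := fun k =>
    ⟨by linarith [(hγ k).1], by linarith [(hγ k).2]⟩
  have hβm := strictMono_of_interlacing hβ
  have hγm := strictMono_of_interlacing (β := fun j => -γ j) hγ'
  have hβ0 : ∀ j, 0 < β j := fun j => hβ00.trans_le (hβm.monotone (Fin.zero_le j))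
  have hγ0 : ∀ j, γ j < 0 := fun j =>
    (neg_le_neg_iff.1 (hγm.monotone (Fin.zero_le j))).trans_lt hγ00
  have hηβ := interlacing_ne hβ
  have hηγ : ∀ i j, η i ≠ γ j := fun i j => ((hγ0 j).trans (hη i)).ne'
  have hθβ : ∀ l j, θ l + β j ≠ 0 := fun l j => (add_pos (hθ l) (hβ0 j)).ne'
  have hθγ : ∀ l j, θ l + γ j ≠ 0 := fun l j e =>
    interlacing_ne (β := fun j => -γ j) hγ' l j (by linarith)
  have hc : 0 < σ ^ 2 / 2 := by positivity
  have hroot : ∀ ζ, (∀ i, η i ≠ ζ) → (∀ l, θ l + ζ ≠ 0) → G ζ = α →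
      -(lam + α) + μ * ζ + σ ^ 2 / 2 * ζ ^ 2 +
        (∑ i, lam * p_u * p i * η i / (η i - ζ) +
          ∑ l, lam * q_d * q l * θ l / (θ l + ζ)) = 0 := by
    intro ζ h1 h2 h3
    rw [hG ζ (fun i => (h1 i).symm) (fun l e => h2 l (by linarith))] at h3
    have h4 : ∑ i, lam * p_u * p i * η i / (η i - ζ) =
        lam * p_u * ∑ i, p i * η i / (η i - ζ) := by
      rw [Finset.mul_sum]; exact Finset.sum_congr rfl fun i _ => by ring
    have h5 : ∑ l, lam * q_d * q l * θ l / (θ l + ζ) =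
        lam * q_d * ∑ l, q l * θ l / (θ l + ζ) := by
      rw [Finset.mul_sum]; exact Finset.sum_congr rfl fun l _ => by ring
    rw [h4, h5]
    linear_combination h3
  have hFβ := fun j => hroot (β j) (fun i => hηβ i j) (fun l => hθβ l j) (hGβ j)
  have hFγ := fun j => hroot (γ j) (fun i => hηγ i j) (fun l => hθγ l j) (hGγ j)
  have ha := residue_pos_of_interlacing hc hη hθ hηmono hβ0 hγ0 hβ hγ' hFβ hFγ
  have hb := residue_pos_of_interlacing (η := θ) (θ := η)
    (a := fun l => lam * q_d * q l * θ l) (b := fun i => lam * p_u * p i * η i)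
    (β := fun j => -γ j) (γ := fun j => -β j) (d := -(lam + α)) (μ := -μ) hc hθ hη hθmono
    (fun j => neg_pos.2 (hγ0 j)) (fun j => neg_neg_of_pos (hβ0 j)) hγ'
    (by simpa only [neg_neg] using hβ)
    (fun j => by
      simp only [sub_neg_eq_add, ← sub_eq_add_neg]
      linear_combination hFγ j)
    (fun j => by
      simp only [sub_neg_eq_add, ← sub_eq_add_neg]
      linear_combination hFβ j)
  have hρ : ∀ j, (∃ i, rootVec m n β γ j = β i) ∨ ∃ l, rootVec m n β γ j = γ l := by
    intro j
    unfold rootVec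
    split_ifs
    · exact Or.inl ⟨_, rfl⟩
    · exact Or.inr ⟨_, rfl⟩
  have hρinj : Function.Injective (rootVec m n β γ) := by
    intro j k hjk
    unfold rootVec at hjk
    split_ifs at hjk with hj hk hk
    · exact Fin.ext (Fin.mk.inj_iff.1 (hβm.injective hjk))
    · exact absurd hjk ((hγ0 _).trans (hβ0 _)).ne'
    · exact absurd hjk ((hγ0 _).trans (hβ0 _)).ne
    · have := Fin.mk.inj_iff.1 (hγm.injective (neg_inj.2 hjk))
      exact Fin.ext (by omega)
  set ρ := rootVec m n β γ
  have hηρ : ∀ i j, η i ≠ ρ j := fun i j => by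
    rcases hρ j with ⟨k, e⟩ | ⟨k, e⟩ <;> rw [e]
    exacts [hηβ i k, hηγ i k]
  have hθρ : ∀ l j, θ l + ρ j ≠ 0 := fun l j => by
    rcases hρ j with ⟨k, e⟩ | ⟨k, e⟩ <;> rw [e]
    exacts [hθβ l k, hθγ l k]
  have hFρ := fun j => hroot (ρ j) (fun i => hηρ i j) (fun l => hθρ l j) (by
    rcases hρ j with ⟨k, e⟩ | ⟨k, e⟩ <;> rw [e]
    exacts [hGβ k, hGγ k])
  have hkill : -(lam + α) + (∑ i, lam * p_u * p i * η i / η i +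
      ∑ l, lam * q_d * q l * θ l / θ l) < 0 := by
    simp only [mul_div_cancel_right₀ _ (hη _).ne', mul_div_cancel_right₀ _ (hθ _).ne',
      ← Finset.mul_sum, hp, hq]
    linear_combination hα + lam * hpq
  intro hdet
  obtain ⟨w, hw0, hw⟩ := Matrix.exists_mulVec_eq_zero_iff.2 hdet
  have hnonpos : ∀ v, (twoSidedMatrix m n η θ h H ρ).mulVec v = 0 →
      ∀ x ∈ Set.Icc h H, expSum v ρ x ≤ 0 := by
    intro v hv
    have hrow : ∀ i, ∑ j, twoSidedMatrix m n η θ h H ρ i j * v j = 0 := fun i => congrFun hv i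
    refine expSum_nonpos_of_exit_conditions hc.le hη hθ (fun i => (ha i).le)
      (fun l => (hb l).le) hηρ hθρ hFρ hkill ?_ ?_ (fun l => ?_) (fun i => ?_)
    · rw [← hrow ⟨0, by omega⟩]
      exact Finset.sum_congr rfl fun j _ => by simp [twoSidedMatrix, mul_comm]
    · rw [← hrow ⟨1, by omega⟩]
      exact Finset.sum_congr rfl fun j _ => by simp [twoSidedMatrix, mul_comm]
    · rw [← hrow ⟨l + 2, by omega⟩]
      refine Finset.sum_congr rfl fun j _ => ?_
      simp [twoSidedMatrix]
      ring
    · rw [← hrow ⟨i + n + 2, by omega⟩]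
      refine Finset.sum_congr rfl fun j _ => ?_
      simp [twoSidedMatrix]
      ring
  refine hw0 (eq_zero_of_expSum_eq_zero_on_Ioo hρinj hhH fun x hx => ?_)
  refine le_antisymm (hnonpos w hw x (Set.Ioo_subset_Icc_self hx)) ?_
  have hneg := hnonpos (-w) (by rw [Matrix.mulVec_neg, hw, neg_zero]) x
    (Set.Ioo_subset_Icc_self hx)
  simpa [expSum] using hneg
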